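/- Let K ≥ 2, let s₀, s₁ ∈ ℝ^K with s₀_k ≠ 0 for all k, and let λ ∈ ℝ^K with λ_k ≠ 0 for all k. For k ≠ l set Δ_{k,l} := s₀_k s₁_l − s₁_k s₀_l. Let W ∈ ℝ^{K×K} have zero diagonal and satisfy: (i) for every k ≠ l with W_{k,l} ≠ 0, Δ_{k,l} ≠ 0; (ii) for every k, Σ_{l=1}^K (k − l) W_{k,l} = 0. Define the matrix W̃ by W̃_{k,l} := (l − k) W_{k,l} / (λ_k λ_l Δ_{k,l}) when k ≠ l and W_{k,l} ≠ 0, and W̃_{k,l} := 0 otherwise; and define the diagonal matrix G̃ by G̃_{k,k} := (λ_k s₀_k)⁻¹ Σ_{j=1}^K W̃_{k,j} λ_j s₀_j. Let Λ := diag(λ₁, …, λ_K) and let S̃ ∈ ℝ^{K×2} have columns s₀ and s₁. Then (G̃ − W̃) Λ S̃ = 0 (the K×2 zero matrix). -/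

import Mathlib

open Matrix

/-- Core linear-algebra claim of the Q modification for P-splines with
an RW2 penalty: with `W̃` and `G̃` built from a weight matrix `W` having zero diagonal
and satisfying the first-moment row condition, the matrix `(G̃ − W̃) Λ S̃` vanishes,
where `S̃` has columns `s₀, s₁`. -/
theorem stmt8 {K : ℕ} (hK : 2 ≤ K) (s0 s1 : Fin K → ℝ)
    (hs0 : ∀ k, s0 k ≠ 0) (lam : Fin K → ℝ) (hlam : ∀ k, lam k ≠ 0)
    (Δ : Fin K → Fin K → ℝ) (hΔ : ∀ k l, Δ k l = s0 k * s1 l - s1 k * s0 l)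
    (W : Matrix (Fin K) (Fin K) ℝ) (hWdiag : ∀ k, W k k = 0)
    (hWΔ : ∀ k l, k ≠ l → W k l ≠ 0 → Δ k l ≠ 0)
    (hWrow : ∀ k : Fin K, ∑ l : Fin K, ((k.val : ℝ) - (l.val : ℝ)) * W k l = 0)
    (Wt : Matrix (Fin K) (Fin K) ℝ)
    (hWt : ∀ k l, Wt k l =
      if k ≠ l ∧ W k l ≠ 0 then
        ((l.val : ℝ) - (k.val : ℝ)) * W k l / (lam k * lam l * Δ k l)
      else 0)
    (Gt : Matrix (Fin K) (Fin K) ℝ)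
    (hGt : Gt = Matrix.diagonal (fun k => (lam k * s0 k)⁻¹ * ∑ j, Wt k j * lam j * s0 j))
    (Lam : Matrix (Fin K) (Fin K) ℝ) (hLam : Lam = Matrix.diagonal lam)
    (St : Matrix (Fin K) (Fin 2) ℝ)
    (hSt : ∀ k, St k 0 = s0 k ∧ St k 1 = s1 k) :
    (Gt - Wt) * Lam * St = 0 := by
  have key : ∀ k, s0 k * ∑ l, Wt k l * lam l * s1 l = s1 k * ∑ l, Wt k l * lam l * s0 l := by
    intro k
    have h1 : ∀ l, lam k * (Wt k l * lam l * Δ k l) = -(((k.val : ℝ) - (l.val : ℝ)) * W k l) := by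
      intro l
      rw [hWt]
      split_ifs with h
      · have h2 := hWΔ k l h.1 h.2
        have h3 := hlam k
        have h4 := hlam l
        field_simp
        ring
      · by_cases hkl : k = l
        · subst hkl
          simp
        · have h5 : W k l = 0 := by
            by_contra h6
            exact h ⟨hkl, h6⟩
          simp [h5]
    have h2 : lam k * ∑ l, Wt k l * lam l * Δ k l = 0 := by
      rw [Finset.mul_sum, Finset.sum_congr rfl (fun l _ => h1 l), Finset.sum_neg_distrib,
        hWrow k, neg_zero]
    have h3 := (mul_eq_zero.mp h2).resolve_left (hlam k)
    rw [← sub_eq_zero, Finset.mul_sum, Finset.mul_sum, ← Finset.sum_sub_distrib, ← h3]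
    refine Finset.sum_congr rfl (fun l _ => ?_)
    rw [hΔ]
    ring
  have entry : ∀ k c, ((Gt - Wt) * Lam * St) k c =
      (lam k * s0 k)⁻¹ * (∑ j, Wt k j * lam j * s0 j) * (lam k * St k c)
        - ∑ l, Wt k l * lam l * St l c := by
    intro k c
    rw [hLam, Matrix.mul_apply]
    simp only [Matrix.mul_diagonal, Matrix.sub_apply, sub_mul, Finset.sum_sub_distrib]
    congr 1
    rw [hGt, Finset.sum_eq_single k]
    · rw [Matrix.diagonal_apply_eq]
      ring
    · intro b _ hb
      rw [Matrix.diagonal_apply_ne _ hb.symm]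
      ring
    · simp
  ext k c
  rw [entry, Matrix.zero_apply]
  have h3 := hlam k
  have h4 := hs0 k
  fin_cases c
  · simp only [Fin.zero_eta, fun l => (hSt l).1]
    field_simp
    ring
  · simp only [Fin.mk_one, fun l => (hSt l).2]
    have := key k
    generalize (∑ l, Wt k l * lam l * s1 l) = B at *
    generalize (∑ l, Wt k l * lam l * s0 l) = A at *
    field_simp
    linarith
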